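/- Fix reals v and h with 0 < v < h and h > 2. For each integer a ≥ 1, let δ_a ∈ (0, 1/2) be the unique real with log(1 + e^{−2πδ_a}) = e^{−2πah} · (−log(1 − e^{−2πδ_a})), and let y_a > 0 be the unique real with h(y_a + δ_a) − h(δ_a) = a·v, where h(y) = −(1/(2π)) · log(−log(1 − e^{−2πy})). For y ≥ 0 set w_a(y) = −log(1 − e^{−2π(y + δ_a)}). Then inf_{0 ≤ y ≤ y_a} (e^{w_a(y)} − 1)/w_a(y) → +∞ as a → ∞. -/

import Mathlib

open Real Set Filter

/-- `h(y) = -(1/(2π)) log(-log(1 - e^{-2πy}))` (real logarithms). -/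
noncomputable def hfun (y : ℝ) : ℝ :=
  -(1 / (2 * π)) * Real.log (-Real.log (1 - Real.exp (-2 * π * y)))

theorem neg_log_one_sub_exp_pos {x : ℝ} (hx : 0 < x) :
    0 < -Real.log (1 - Real.exp (-2 * π * x)) := by
  have h1 : Real.exp (-2 * π * x) < 1 := by
    rw [Real.exp_lt_one_iff]
    nlinarith [mul_pos Real.pi_pos hx]
  have h2 := Real.exp_pos (-2 * π * x)
  have := Real.log_neg (x := 1 - Real.exp (-2 * π * x)) (by linarith) (by linarith)
  linarith

theorem neg_log_one_sub_exp_anti {x z : ℝ} (hx : 0 < x) (hxz : x ≤ z) :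
    -Real.log (1 - Real.exp (-2 * π * z)) ≤ -Real.log (1 - Real.exp (-2 * π * x)) := by
  have h1 : Real.exp (-2 * π * x) < 1 := by
    rw [Real.exp_lt_one_iff]
    nlinarith [mul_pos Real.pi_pos hx]
  have h2 : Real.exp (-2 * π * z) ≤ Real.exp (-2 * π * x) := by
    apply Real.exp_le_exp.mpr
    nlinarith [Real.pi_pos]
  have := Real.log_le_log (x := 1 - Real.exp (-2 * π * x)) (by linarith)
    (show _ ≤ 1 - Real.exp (-2 * π * z) by linarith)
  linarith

theorem half_le_exp_sub_one_div {w : ℝ} (hw : 0 < w) : w / 2 ≤ (Real.exp w - 1) / w := by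
  rw [le_div_iff₀ hw]
  nlinarith [Real.quadratic_le_exp_of_nonneg hw.le]

theorem neg_log_one_sub_exp_eq_of_hfun_sub_eq {x z c : ℝ} (hx : 0 < x) (hz : 0 < z)
    (h : hfun z - hfun x = c) :
    -Real.log (1 - Real.exp (-2 * π * z)) =
      Real.exp (-2 * π * c) * -Real.log (1 - Real.exp (-2 * π * x)) := by
  have hwx := neg_log_one_sub_exp_pos hx
  have hwz := neg_log_one_sub_exp_pos hz
  unfold hfun at h
  set X := -Real.log (1 - Real.exp (-2 * π * x))
  set Z := -Real.log (1 - Real.exp (-2 * π * z))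
  have hlog : Real.log Z = -2 * π * c + Real.log X := by
    rw [← h]
    field_simp
    ring
  rw [← Real.exp_log hwz, hlog, Real.exp_add, Real.exp_log hwx]

/-- (Lemma 2.3.1 of the paper, on the imaginary axis.) Fix `0 < v < h`,
`h > 2`. For each integer `a ≥ 1` let `δ_a ∈ (0,1/2)` solve
`log(1 + e^{-2πδ_a}) = e^{-2πah}(-log(1 - e^{-2πδ_a}))`, let `y_a > 0` solve
`h(y_a + δ_a) - h(δ_a) = a·v`, and set `w_a(y) = -log(1 - e^{-2π(y+δ_a)})`. Then
`inf_{0 ≤ y ≤ y_a} (e^{w_a(y)} - 1)/w_a(y) → +∞` as `a → ∞`. -/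
theorem stmt15 (v h : ℝ) (hv : 0 < v) (hvh : v < h) (hh : 2 < h)
    (δ y : ℕ → ℝ)
    (hδ : ∀ a : ℕ, 1 ≤ a → δ a ∈ Ioo (0 : ℝ) (1 / 2) ∧
      Real.log (1 + Real.exp (-2 * π * δ a)) =
        Real.exp (-2 * π * (a : ℝ) * h) * (-Real.log (1 - Real.exp (-2 * π * δ a))))
    (hy : ∀ a : ℕ, 1 ≤ a → 0 < y a ∧ hfun (y a + δ a) - hfun (δ a) = (a : ℝ) * v) :
    Tendsto
      (fun a : ℕ => ⨅ t : Icc (0 : ℝ) (y a),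
        (Real.exp (-Real.log (1 - Real.exp (-2 * π * ((t : ℝ) + δ a)))) - 1) /
          (-Real.log (1 - Real.exp (-2 * π * ((t : ℝ) + δ a)))))
      atTop atTop := by
  have hpi := Real.pi_pos
  set c := Real.log (1 + Real.exp (-π)) with hc
  have hc0 : 0 < c := Real.log_pos (by linarith [Real.exp_pos (-π)])
  have hB : Tendsto (fun a : ℕ => Real.exp (2 * π * (h - v) * (a : ℝ)) * (c / 2)) atTop atTop := by
    refine Tendsto.atTop_mul_const (by positivity) (Real.tendsto_exp_atTop.comp ?_)
    exact Tendsto.const_mul_atTop (mul_pos (by positivity) (by linarith))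
      tendsto_natCast_atTop_atTop
  refine tendsto_atTop_mono' atTop ?_ hB
  filter_upwards [eventually_ge_atTop 1] with a ha
  obtain ⟨⟨hδ0, hδ1⟩, hδe⟩ := hδ a ha
  obtain ⟨hy0, hye⟩ := hy a ha
  have hcle : c ≤ Real.log (1 + Real.exp (-2 * π * δ a)) := by
    apply Real.log_le_log (by positivity)
    have : Real.exp (-π) ≤ Real.exp (-2 * π * δ a) := Real.exp_le_exp.mpr (by nlinarith)
    linarith
  have hW : -Real.log (1 - Real.exp (-2 * π * δ a)) =
      Real.exp (2 * π * (a : ℝ) * h) * Real.log (1 + Real.exp (-2 * π * δ a)) := by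
    rw [hδe, ← mul_assoc, ← Real.exp_add]
    ring_nf
    simp
  have hend : Real.exp (2 * π * (h - v) * (a : ℝ)) * c ≤
      -Real.log (1 - Real.exp (-2 * π * (y a + δ a))) := by
    rw [neg_log_one_sub_exp_eq_of_hfun_sub_eq hδ0 (by linarith) hye, hW, ← mul_assoc,
      ← Real.exp_add,
      show -2 * π * ((a : ℝ) * v) + 2 * π * (a : ℝ) * h = 2 * π * (h - v) * (a : ℝ) by ring]
    gcongr
  have : Nonempty (Icc (0 : ℝ) (y a)) := ⟨⟨0, le_rfl, hy0.le⟩⟩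
  refine le_ciInf fun ⟨t, ht0, ht1⟩ => ?_
  have hanti := neg_log_one_sub_exp_anti (x := t + δ a) (z := y a + δ a) (by linarith)
    (by linarith)
  have hhalf := half_le_exp_sub_one_div (neg_log_one_sub_exp_pos (x := t + δ a) (by linarith))
  refine le_trans ?_ hhalf
  linarith
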